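/- arXiv:1403.2512 — 5 statements merged into one kernel-verified Lean document; each statement's English description precedes it below -/
import Mathlib

section
/- The sets {⌊φ·n⌋ : n ≥ 1} and {⌊φ²·n⌋ : n ≥ 1} are complementary in the positive integers: their union is the set of all positive integers and their intersection is empty. -/
noncomputable def phi : ℝ := (1 + Real.sqrt 5) / 2
noncomputable def wA (n : ℕ) : ℕ := ⌊phi * n⌋₊
noncomputable def wB (n : ℕ) : ℕ := ⌊phi ^ 2 * n⌋₊

theorem natCast_mem_beattySeq_pos_iff {r : ℝ} (hr : 0 ≤ r) (m : ℕ) :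
    (m : ℤ) ∈ {beattySeq r k | k > 0} ↔ ∃ n : ℕ, 1 ≤ n ∧ ⌊r * n⌋₊ = m := by
  have floor_eq (n : ℕ) : beattySeq r n = (⌊r * n⌋₊ : ℤ) := by
    rw [beattySeq, mul_comm, Int.cast_natCast, Int.natCast_floor_eq_floor (by positivity)]
  constructor
  · rintro ⟨k, hk, hkm⟩
    lift k to ℕ using hk.le
    rw [floor_eq] at hkm
    exact ⟨k, by omega, by exact_mod_cast hkm⟩
  · rintro ⟨n, hn, rfl⟩
    exact ⟨n, by omega, floor_eq n⟩

theorem one_lt_phi : 1 < phi := Real.one_lt_goldenRatio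

theorem phi_sq : phi ^ 2 = phi + 1 := Real.goldenRatio_sq

theorem holderConjugate_phi_phi_sq : phi.HolderConjugate (phi ^ 2) := by
  rw [Real.holderConjugate_iff]
  refine ⟨one_lt_phi, ?_⟩
  have phi_pos : 0 < phi := one_pos.trans one_lt_phi
  field_simp
  exact phi_sq.symm

theorem wythoff_beatty_complementary :
    ({m : ℕ | ∃ n, 1 ≤ n ∧ wA n = m} ∪ {m : ℕ | ∃ n, 1 ≤ n ∧ wB n = m} = {m : ℕ | 0 < m}) ∧
    ({m : ℕ | ∃ n, 1 ≤ n ∧ wA n = m} ∩ {m : ℕ | ∃ n, 1 ≤ n ∧ wB n = m} = ∅) := by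
  have partition (m : ℕ) :
      Xor (∃ n, 1 ≤ n ∧ wA n = m) (∃ n, 1 ≤ n ∧ wB n = m) ↔ 0 < m := by
    have h := Set.ext_iff.1 (Irrational.beattySeq_symmDiff_beattySeq_pos
      holderConjugate_phi_phi_sq Real.goldenRatio_irrational) m
    have phi_nonneg : 0 ≤ phi := (one_pos.trans one_lt_phi).le
    rw [Set.mem_symmDiff, natCast_mem_beattySeq_pos_iff phi_nonneg,
      natCast_mem_beattySeq_pos_iff (by positivity)] at h
    exact h.trans Int.natCast_pos
  have wA_pos (n : ℕ) (hn : 1 ≤ n) : 0 < wA n :=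
    Nat.floor_pos.2 (one_le_mul_of_one_le_of_one_le one_lt_phi.le (by exact_mod_cast hn))
  have wB_pos (n : ℕ) (hn : 1 ≤ n) : 0 < wB n :=
    Nat.floor_pos.2 (one_le_mul_of_one_le_of_one_le (one_le_pow₀ one_lt_phi.le)
      (by exact_mod_cast hn))
  constructor
  · ext m
    constructor
    · rintro (⟨n, hn, rfl⟩ | ⟨n, hn, rfl⟩)
      · exact wA_pos n hn
      · exact wB_pos n hn
    · intro hm
      exact ((partition m).2 hm).or
  · refine Set.eq_empty_iff_forall_notMem.2 fun m ⟨hA, hB⟩ ↦ ?_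
    have hm : 0 < m := by
      obtain ⟨n, hn, rfl⟩ := hA
      exact wA_pos n hn
    rcases (partition m).2 hm with h | h
    · exact h.2 hB
    · exact h.2 hA
end

section
/- For natural numbers m < n, there is no legal move in Wythoff's game from the position (A_n, B_n) to either of the positions (A_m, B_m) or (B_m, A_m). In particular, for m < n one has B_n − B_m ≠ A_n − A_m; indeed (B_n − B_m) − (A_n − A_m) = n − m. -/
/-- A legal move in Wythoff's game from `p` to `q`. -/
def WythoffMove (p q : ℕ × ℕ) : Prop :=
  (∃ t, 1 ≤ t ∧ t ≤ p.1 ∧ q = (p.1 - t, p.2)) ∨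
  (∃ t, 1 ≤ t ∧ t ≤ p.2 ∧ q = (p.1, p.2 - t)) ∨
  (∃ s, 1 ≤ s ∧ s ≤ min p.1 p.2 ∧ q = (p.1 - s, p.2 - s))

/-- `S` is the set of P-positions of the game with move relation `move`. -/
def IsPPositions (move : ℕ × ℕ → ℕ × ℕ → Prop) (S : Set (ℕ × ℕ)) : Prop :=
  (∀ p ∈ S, ∀ q ∈ S, ¬ move p q) ∧ (∀ p ∉ S, ∃ q ∈ S, move p q)

theorem phi_eq_goldenRatio : phi = Real.goldenRatio := rfl

theorem phi_lt_two : phi < 2 := Real.goldenRatio_lt_two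

theorem phi_mul_nonneg (n : ℕ) : 0 ≤ phi * n :=
  mul_nonneg (zero_le_one.trans one_lt_phi.le) n.cast_nonneg

theorem wB_eq_wA_add (n : ℕ) : wB n = wA n + n := by
  rw [wB, wA, phi_sq, add_mul, one_mul, Nat.floor_add_natCast (phi_mul_nonneg n)]

theorem wA_strictMono : StrictMono wA := by
  refine strictMono_nat_of_lt_succ fun n => Nat.lt_of_succ_le (Nat.le_floor ?_)
  have h1 : (wA n : ℝ) ≤ phi * n := Nat.floor_le (phi_mul_nonneg n)
  push_cast
  linarith [one_lt_phi]

/-- The lower and upper Wythoff sequences have no common positive term. -/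
theorem wA_ne_wB {m n : ℕ} (hn : 0 < n) : wA n ≠ wB m := by
  intro h
  have hA : (wA n : ℝ) ≤ phi * n := Nat.floor_le (phi_mul_nonneg n)
  have hA' : phi * n < wA n + 1 := Nat.lt_floor_add_one _
  have hB : (wA m : ℝ) ≤ phi * m := Nat.floor_le (phi_mul_nonneg m)
  have hB' : phi * m < wA m + 1 := Nat.lt_floor_add_one _
  rw [wB_eq_wA_add] at h
  have hk : (wA n : ℝ) = wA m + m := by exact_mod_cast h
  have h1 := one_lt_phi
  have h2 := phi_lt_two
  have hsq := phi_sq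
  have lower : (wA n : ℝ) ≤ n + m := by nlinarith
  have upper : (n + m : ℝ) < wA n + 1 := by nlinarith
  have hsum : wA n = n + m := by
    have lower' : wA n ≤ n + m := by exact_mod_cast lower
    have upper' : n + m < wA n + 1 := by exact_mod_cast upper
    omega
  have hsum' : (wA n : ℝ) = n + m := by exact_mod_cast hsum
  have heq : phi * m = n := le_antisymm (by nlinarith) (by linarith)
  have hm : m ≠ 0 := by
    rintro rfl
    have : (0 : ℝ) < n := by exact_mod_cast hn
    simp at heq
    linarith
  exact (Real.goldenRatio_irrational.mul_natCast hm).ne_nat n heq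

theorem no_move_between_wythoff_P (m n : ℕ) (h : m < n) :
    (¬ WythoffMove (wA n, wB n) (wA m, wB m)) ∧
    (¬ WythoffMove (wA n, wB n) (wB m, wA m)) ∧
    (wB n - wB m ≠ wA n - wA m) ∧
    ((wB n - wB m) - (wA n - wA m) = n - m) := by
  have hlt := wA_strictMono h
  have hne : wA n ≠ wB m := wA_ne_wB (by omega)
  have hn := wB_eq_wA_add n
  have hm := wB_eq_wA_add m
  refine ⟨?_, ?_, by omega, by omega⟩ <;>
    rintro (⟨t, h1, h2, h3⟩ | ⟨t, h1, h2, h3⟩ | ⟨t, h1, h2, h3⟩) <;>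
    simp only [Prod.mk.injEq] at h2 h3 <;> omega
end

section
/- Let k ≥ 0 and l > 0 be integers, and let S⁰_k and S⁰_{k+l} denote the sets of P-positions of the games W_k and W_{k+l} respectively. Then S⁰_{k+l} = {(i,i) : 0 ≤ i < l} ∪ {(a+l, b+l) : (a,b) ∈ S⁰_k}. -/
/-- A legal move in the game `W_k` from `p` to `q`: a Nim move, or a diagonal move
whose resulting smaller entry is at least `k`. -/
def WkMove (k : ℕ) (p q : ℕ × ℕ) : Prop :=
  (∃ t, 1 ≤ t ∧ t ≤ p.1 ∧ q = (p.1 - t, p.2)) ∨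
  (∃ t, 1 ≤ t ∧ t ≤ p.2 ∧ q = (p.1, p.2 - t)) ∨
  (∃ s, 1 ≤ s ∧ s ≤ min p.1 p.2 ∧ k ≤ min (p.1 - s) (p.2 - s) ∧ q = (p.1 - s, p.2 - s))

/-- `G` is the Sprague–Grundy function of the game with move relation `move`:
at every position, `G` takes the mex of the values of the options. -/
def IsGrundy (move : ℕ × ℕ → ℕ × ℕ → Prop) (G : ℕ × ℕ → ℕ) : Prop :=
  ∀ p, (∀ q, move p q → G q ≠ G p) ∧ (∀ v, v < G p → ∃ q, move p q ∧ G q = v)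

theorem wkMove_iff {k a b c d : ℕ} :
    WkMove k (a, b) (c, d) ↔ (c < a ∧ d = b) ∨ (c = a ∧ d < b) ∨
      (c < a ∧ k ≤ c ∧ k ≤ d ∧ a + d = b + c) := by
  simp only [WkMove, Prod.mk.injEq]
  constructor
  · rintro (⟨t, h⟩ | ⟨t, h⟩ | ⟨t, h⟩) <;> omega
  · rintro (h | h | h)
    · exact Or.inl ⟨a - c, by omega⟩
    · exact Or.inr (Or.inl ⟨b - d, by omega⟩)
    · exact Or.inr (Or.inr ⟨a - c, by omega⟩)

theorem wkMove_add_iff {k l a b c d : ℕ} :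
    WkMove (k + l) (a + l, b + l) (c + l, d + l) ↔ WkMove k (a, b) (c, d) := by
  simp only [wkMove_iff]
  omega

theorem WkMove.sum_lt {k : ℕ} {p q : ℕ × ℕ} (h : WkMove k p q) : q.1 + q.2 < p.1 + p.2 := by
  have := wkMove_iff.1 h
  omega

/-- The set of P-positions is unique when every move decreases a natural-valued measure. -/
theorem IsPPositions.unique {move : ℕ × ℕ → ℕ × ℕ → Prop} (f : ℕ × ℕ → ℕ)
    (hf : ∀ p q, move p q → f q < f p) {S T : Set (ℕ × ℕ)}
    (hS : IsPPositions move S) (hT : IsPPositions move T) : S = T := by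
  suffices h : ∀ n p, f p = n → (p ∈ S ↔ p ∈ T) from Set.ext fun p => h _ p rfl
  intro n
  induction n using Nat.strong_induction_on with
  | _ n ih =>
    rintro p rfl
    constructor
    · intro hp
      by_contra hpT
      obtain ⟨q, hq, hm⟩ := hT.2 p hpT
      exact hS.1 p hp q ((ih _ (hf _ _ hm) q rfl).2 hq) hm
    · intro hp
      by_contra hpS
      obtain ⟨q, hq, hm⟩ := hS.2 p hpS
      exact hT.1 p hp q ((ih _ (hf _ _ hm) q rfl).1 hq) hm

theorem Wk_P_positions_translation (k l : ℕ) (hl : 0 < l)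
    (S T : Set (ℕ × ℕ))
    (hS : IsPPositions (WkMove k) S) (hT : IsPPositions (WkMove (k + l)) T) :
    T = {p : ℕ × ℕ | ∃ i, i < l ∧ p = (i, i)} ∪
        {p : ℕ × ℕ | ∃ a b, (a, b) ∈ S ∧ p = (a + l, b + l)} := by
  refine hT.unique (fun p => p.1 + p.2) (fun _ _ h => h.sum_lt) ⟨?_, ?_⟩
  · rintro _ (⟨i, hi, rfl⟩ | ⟨a, b, hab, rfl⟩) _ (⟨j, hj, rfl⟩ | ⟨c, d, hcd, rfl⟩) hm
    · have := wkMove_iff.1 hm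
      omega
    · have := wkMove_iff.1 hm
      omega
    · have := wkMove_iff.1 hm
      omega
    · exact hS.1 _ hab _ hcd (wkMove_add_iff.1 hm)
  · rintro ⟨a, b⟩ hp
    have hdiag : ∀ i, i < l → ¬ (a = i ∧ b = i) := by
      rintro i hi ⟨rfl, rfl⟩
      exact hp (Or.inl ⟨_, hi, rfl⟩)
    by_cases hmin : min a b < l
    · refine ⟨(min a b, min a b), Or.inl ⟨_, hmin, rfl⟩, wkMove_iff.2 ?_⟩
      have := hdiag _ hmin
      omega
    · obtain ⟨a, rfl⟩ := Nat.exists_eq_add_of_le' (show l ≤ a by omega)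
      obtain ⟨b, rfl⟩ := Nat.exists_eq_add_of_le' (show l ≤ b by omega)
      obtain ⟨⟨c, d⟩, hcd, hm⟩ := hS.2 (a, b) fun h => hp (Or.inr ⟨a, b, h, rfl⟩)
      exact ⟨(c + l, d + l), Or.inr ⟨c, d, hcd, rfl⟩, wkMove_add_iff.2 hm⟩
end

section
/- For every integer k ≥ 0, the set of P-positions of the game W_1 is identical to the set of P-positions of the game T_k. -/
/-- A legal move in the game `T_k` from `p` to `q`: a Nim move, or a diagonal move
removing `s` tokens from both piles, with `min p.1 p.2 - s > 0` and the integer ratios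
of larger over smaller entry before and after the move differing by at most `k`. -/
def TkMove (k : ℕ) (p q : ℕ × ℕ) : Prop :=
  (∃ t, 1 ≤ t ∧ t ≤ p.1 ∧ q = (p.1 - t, p.2)) ∨
  (∃ t, 1 ≤ t ∧ t ≤ p.2 ∧ q = (p.1, p.2 - t)) ∨
  (∃ s, 1 ≤ s ∧ s ≤ min p.1 p.2 ∧ 0 < min p.1 p.2 - s ∧
    |((max (p.1 - s) (p.2 - s) / min (p.1 - s) (p.2 - s) : ℕ) : ℤ) -
      ((max p.1 p.2 / min p.1 p.2 : ℕ) : ℤ)| ≤ (k : ℤ) ∧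
    q = (p.1 - s, p.2 - s))

/-- A legal move in the game `W_1` from `p` to `q`: a Nim move, or a diagonal move
whose resulting smaller entry is at least `1`. -/
def W1Move (p q : ℕ × ℕ) : Prop :=
  (∃ t, 1 ≤ t ∧ t ≤ p.1 ∧ q = (p.1 - t, p.2)) ∨
  (∃ t, 1 ≤ t ∧ t ≤ p.2 ∧ q = (p.1, p.2 - t)) ∨
  (∃ s, 1 ≤ s ∧ s ≤ min p.1 p.2 ∧ 1 ≤ min (p.1 - s) (p.2 - s) ∧ q = (p.1 - s, p.2 - s))

theorem max_div_min_eq_one {a b : ℕ} (h : max a b < 2 * min a b) : max a b / min a b = 1 :=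
  Nat.div_eq_of_lt_le (by omega) (by omega)

theorem TkMove.toW1Move {k : ℕ} {p q : ℕ × ℕ} (h : TkMove k p q) : W1Move p q := by
  rcases h with h | h | ⟨s, h1, h2, h3, -, rfl⟩
  · exact Or.inl h
  · exact Or.inr (Or.inl h)
  · exact Or.inr (Or.inr ⟨s, h1, h2, by omega, rfl⟩)

theorem TkMove.mono {k l : ℕ} (hkl : k ≤ l) {p q : ℕ × ℕ} (h : TkMove k p q) :
    TkMove l p q := by
  rcases h with h | h | ⟨s, h1, h2, h3, h4, rfl⟩
  · exact Or.inl h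
  · exact Or.inr (Or.inl h)
  · exact Or.inr (Or.inr ⟨s, h1, h2, h3, h4.trans (by exact_mod_cast hkl), rfl⟩)

theorem TkMove.swap {k : ℕ} {p q : ℕ × ℕ} (h : TkMove k p q) : TkMove k p.swap q.swap := by
  rcases h with ⟨t, h1, h2, rfl⟩ | ⟨t, h1, h2, rfl⟩ | ⟨s, h1, h2, h3, h4, rfl⟩
  · exact Or.inr (Or.inl ⟨t, h1, h2, rfl⟩)
  · exact Or.inl ⟨t, h1, h2, rfl⟩
  · refine Or.inr (Or.inr ⟨s, h1, ?_, ?_, ?_, rfl⟩) <;>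
      simp only [Prod.fst_swap, Prod.snd_swap] <;>
      simpa only [max_comm, min_comm] using ‹_›

theorem W1Move.swap {p q : ℕ × ℕ} (h : W1Move p q) : W1Move p.swap q.swap := by
  rcases h with ⟨t, h1, h2, rfl⟩ | ⟨t, h1, h2, rfl⟩ | ⟨s, h1, h2, h3, rfl⟩
  · exact Or.inr (Or.inl ⟨t, h1, h2, rfl⟩)
  · exact Or.inl ⟨t, h1, h2, rfl⟩
  · refine Or.inr (Or.inr ⟨s, h1, ?_, ?_, rfl⟩) <;>
      simp only [Prod.fst_swap, Prod.snd_swap] <;> omega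

/-- A `W1Move` is a `TkMove` as soon as the larger entry of the target is less than twice the
smaller one, whenever both are positive. -/
theorem W1Move.toTkMove (k : ℕ) {p q : ℕ × ℕ} (h : W1Move p q)
    (hq : 1 ≤ min q.1 q.2 → max q.1 q.2 < 2 * min q.1 q.2) : TkMove k p q := by
  rcases h with h | h | ⟨s, h1, h2, h3, rfl⟩
  · exact Or.inl h
  · exact Or.inr (Or.inl h)
  · have hq' := hq h3
    refine Or.inr (Or.inr ⟨s, h1, h2, by omega, ?_, rfl⟩)
    simp only at hq'
    rw [max_div_min_eq_one hq', max_div_min_eq_one (a := p.1) (b := p.2) (by omega)]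
    simp

theorem IsPPositions.swap {M : ℕ × ℕ → ℕ × ℕ → Prop} {S : Set (ℕ × ℕ)}
    (h : IsPPositions M S) :
    IsPPositions (fun p q => M p.swap q.swap) {p | p.swap ∈ S} := by
  refine ⟨fun p hp q hq => h.1 _ hp _ hq, fun p hp => ?_⟩
  obtain ⟨q, hq, hm⟩ := h.2 _ hp
  exact ⟨q.swap, by simpa using hq, by simpa using hm⟩

section Between

variable {M : ℕ × ℕ → ℕ × ℕ → Prop} {S : Set (ℕ × ℕ)}

theorem IsPPositions.zero_notMem (hT : ∀ p q, TkMove 0 p q → M p q)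
    (hW : ∀ p q, M p q → W1Move p q) (h : IsPPositions M S) {y : ℕ} (hy : 1 ≤ y) :
    (0, y) ∉ S := by
  intro hyS
  have h0 : (0, 0) ∈ S := by
    by_contra h0
    obtain ⟨q, -, hm⟩ := h.2 _ h0
    rcases hW _ _ hm with ⟨t, h1, h2, -⟩ | ⟨t, h1, h2, -⟩ | ⟨t, h1, h2, -, -⟩ <;>
      simp at h2 <;> omega
  exact h.1 _ hyS _ h0 (hT _ _ (Or.inr (Or.inl ⟨y, hy, le_rfl, by simp⟩)))

open Classical in
/-- The P-positions with positive entries on or above the main diagonal lie on the diagonals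
`0, 1, 2, …` in the order of their first entries. -/
theorem IsPPositions.diff_eq_count (hT : ∀ p q, TkMove 0 p q → M p q)
    (hW : ∀ p q, M p q → W1Move p q) (h : IsPPositions M S) (i d : ℕ)
    (hS : (i + 1, i + 1 + d) ∈ S) :
    d = Nat.count (fun j => ∃ e, (j + 1, j + 1 + e) ∈ S) i := by
  induction i using Nat.strong_induction_on generalizing d with
  | _ i ih =>
  set Q : ℕ → Prop := fun j => ∃ e, (j + 1, j + 1 + e) ∈ S with hQ
  have below : ∀ j < i, ∀ e, (j + 1, j + 1 + e) ∈ S → e < Nat.count Q i := by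
    intro j hj e he
    rw [ih j hj e he]
    exact Nat.count_strict_mono (p := Q) ⟨e, he⟩ hj
  rcases lt_trichotomy d (Nat.count Q i) with hd | hd | hd
  · exfalso
    have hj : Nat.nth Q d < i := Nat.nth_lt_of_lt_count hd
    obtain ⟨e, he⟩ : Q (Nat.nth Q d) :=
      Nat.nth_mem d fun hf => hd.trans_le (Nat.count_le_card hf i)
    have hed : e = d := by
      rw [ih _ hj e he]
      exact Nat.count_nth fun hf => hd.trans_le (Nat.count_le_card hf i)
    have hle : e ≤ Nat.nth Q d := by
      conv_lhs => rw [ih _ hj e he]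
      exact Nat.count_le _
    generalize Nat.nth Q d = j at *
    subst hed
    refine h.1 _ hS _ he (hT _ _ (W1Move.toTkMove 0 ?_ ?_))
    · refine Or.inr (Or.inr ⟨i - j, by omega, ?_, ?_, ?_⟩)
      · simp only; omega
      · simp only; omega
      · ext <;> simp only <;> omega
    · intro _; simp only; omega
  · exact hd
  · exfalso
    generalize Nat.count Q i = n at *
    have col : ∀ z < i + 1 + d, (i + 1, z) ∉ S := fun z hz hzS =>
      h.1 _ hS _ hzS (hT _ _ (Or.inr (Or.inl ⟨i + 1 + d - z, by omega, by simp only; omega, by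
        ext <;> simp only; omega⟩)))
    obtain ⟨q, hq, hm⟩ := h.2 _ (col (i + 1 + n) (by omega))
    rcases hW _ _ hm with ⟨t, h1, h2, rfl⟩ | ⟨t, h1, h2, rfl⟩ | ⟨t, h1, h2, h3, rfl⟩
    · simp only at h2 hq
      rcases Nat.eq_zero_or_pos (i + 1 - t) with h0 | h0
      · rw [h0] at hq
        exact h.zero_notMem hT hW (by omega) hq
      · have := below (i - t) (by omega) (n + t) (by convert hq using 2 <;> omega)
        omega
    · exact col _ (by simp only at h2 ⊢; omega) hq
    · simp only at h2 h3 hq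
      have := below (i - t) (by omega) n (by convert hq using 2 <;> omega)
      omega

theorem IsPPositions.snd_lt_two_mul_fst (hT : ∀ p q, TkMove 0 p q → M p q)
    (hW : ∀ p q, M p q → W1Move p q) (h : IsPPositions M S) {x y : ℕ} (hx : 1 ≤ x)
    (hxy : x ≤ y) (hS : (x, y) ∈ S) : y < 2 * x := by
  classical
  obtain ⟨i, rfl⟩ := Nat.exists_eq_add_of_le' hx
  obtain ⟨d, rfl⟩ := Nat.exists_eq_add_of_le hxy
  have hd := h.diff_eq_count hT hW i d hS
  have : d ≤ i := hd.trans_le (Nat.count_le _)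
  omega

theorem IsPPositions.max_lt_two_mul_min (hT : ∀ p q, TkMove 0 p q → M p q)
    (hW : ∀ p q, M p q → W1Move p q) (h : IsPPositions M S) {p : ℕ × ℕ} (hp : p ∈ S)
    (h1 : 1 ≤ min p.1 p.2) : max p.1 p.2 < 2 * min p.1 p.2 := by
  rcases le_total p.1 p.2 with hle | hle
  · have := h.snd_lt_two_mul_fst hT hW (x := p.1) (y := p.2) (by omega) hle hp
    omega
  · have := h.swap.snd_lt_two_mul_fst (fun p q hm => hT _ _ hm.swap)
      (fun p q hm => by simpa using (hW _ _ hm).swap) (x := p.2) (y := p.1) (by omega) hle hp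
    omega

end Between

theorem W1_Tk_same_P_positions (k : ℕ) (S : Set (ℕ × ℕ)) :
    IsPPositions W1Move S ↔ IsPPositions (TkMove k) S := by
  constructor
  · intro h
    refine ⟨fun p hp q hq hm => h.1 p hp q hq hm.toW1Move, fun p hp => ?_⟩
    obtain ⟨q, hq, hm⟩ := h.2 p hp
    exact ⟨q, hq, hm.toTkMove k
      (h.max_lt_two_mul_min (fun _ _ => TkMove.toW1Move) (fun _ _ => id) hq)⟩
  · intro h
    refine ⟨fun p hp q hq hm => h.1 p hp q hq (hm.toTkMove k
      (h.max_lt_two_mul_min (fun _ _ => TkMove.mono k.zero_le)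
        (fun _ _ => TkMove.toW1Move) hq)), fun p hp => ?_⟩
    obtain ⟨q, hq, hm⟩ := h.2 p hp
    exact ⟨q, hq, hm.toW1Move⟩
end

section
/- For all natural numbers m and n, the position (A_n + 1, B_n + 1) is different from both (A_m + 2, B_m + 2) and (B_m + 2, A_m + 2). Consequently the sets {(A_n + 1, B_n + 1), (B_n + 1, A_n + 1) : n ≥ 0} and {(0,1), (1,0)} ∪ {(A_m + 2, B_m + 2), (B_m + 2, A_m + 2) : m ≥ 0} are disjoint. -/
theorem wA_zero : wA 0 = 0 := by
  simp [wA]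

theorem translated_sets_disjoint :
    (∀ m n : ℕ, (wA n + 1, wB n + 1) ≠ (wA m + 2, wB m + 2) ∧
      (wA n + 1, wB n + 1) ≠ (wB m + 2, wA m + 2)) ∧
    ({p : ℕ × ℕ | ∃ n, p = (wA n + 1, wB n + 1) ∨ p = (wB n + 1, wA n + 1)} ∩
      ({((0 : ℕ), (1 : ℕ)), ((1 : ℕ), (0 : ℕ))} ∪
        {p : ℕ × ℕ | ∃ m, p = (wA m + 2, wB m + 2) ∨ p = (wB m + 2, wA m + 2)}) = ∅) := by
  have same : ∀ m n : ℕ, ¬(wA n = wA m + 1 ∧ wB n = wB m + 1) := by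
    rintro m n ⟨hA, hB⟩
    rw [wB_eq_wA_add, wB_eq_wA_add] at hB
    obtain rfl : n = m := by omega
    omega
  have swapped : ∀ m n : ℕ, ¬(wA n = wB m + 1 ∧ wB n = wA m + 1) := by
    rintro m n ⟨hA, hB⟩
    rw [wB_eq_wA_add] at hA hB
    obtain rfl : n = 0 := by omega
    rw [wA_zero] at hA
    omega
  refine ⟨fun m n => ⟨fun h => ?_, fun h => ?_⟩, ?_⟩
  · rw [Prod.mk.injEq] at h
    exact same m n (by omega)
  · rw [Prod.mk.injEq] at h
    exact swapped m n (by omega)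
  · rw [Set.eq_empty_iff_forall_notMem]
    rintro ⟨x, y⟩ ⟨⟨n, hn⟩, h⟩
    simp only [Set.mem_union, Set.mem_insert_iff, Set.mem_singleton_iff, Set.mem_ofPred_eq,
      Prod.mk.injEq] at hn h
    rcases h with h | ⟨m, hm⟩
    · omega
    · have := same m n
      have := swapped m n
      omega
end
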